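/- Let p be a prime, r ≥ 1, and let φ be an irreducible unitary representation of SL₄(ℤ/p^rℤ) on a nonzero finite-dimensional complex inner product space V which is new, i.e. the kernel of the reduction homomorphism SL₄(ℤ/p^rℤ) → SL₄(ℤ/p^{r-1}ℤ) is not contained in the kernel of φ. Then there exists a nonzero vector v ∈ V such that for all integers x, y, z, φ([x;y;z]) v = exp(2πi y/p^r) · v. -/

import Mathlib

open Matrix

/-- The matrix `[x;y;z]` in SL₄(ℤ/p^r): the identity except for entries
`x, z, y` in positions (2,3), (2,4), (3,4) (1-indexed). -/
def xyzMat (p r : ℕ) (x y z : ℤ) :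
    Matrix.SpecialLinearGroup (Fin 4) (ZMod (p ^ r)) :=
  ⟨!![1, 0, 0, 0; 0, 1, (x : ZMod (p ^ r)), (z : ZMod (p ^ r));
      0, 0, 1, (y : ZMod (p ^ r)); 0, 0, 0, 1], by
    simp [Matrix.det_succ_row_zero, Fin.sum_univ_succ]⟩


def EE {R : Type*} [CommRing R] {i j : Fin 4} (h : i ≠ j) (x : R) :
    Matrix.SpecialLinearGroup (Fin 4) R := Matrix.SpecialLinearGroup.transvection h x

/-- The underlying matrix. -/
def mm {R : Type*} [CommRing R] (g : SpecialLinearGroup (Fin 4) R) : Matrix (Fin 4) (Fin 4) R :=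
  g.1

lemma SLext {R : Type*} [CommRing R] {A B : SpecialLinearGroup (Fin 4) R}
    (h : mm A = mm B) : A = B := Subtype.ext h

lemma EE_coe {R : Type*} [CommRing R] {i j : Fin 4} (h : i ≠ j) (x : R) :
    mm (EE h x) = 1 + single i j x := rfl

lemma mm_mul {R : Type*} [CommRing R] (A B : SpecialLinearGroup (Fin 4) R) :
    mm (A * B) = mm A * mm B := rfl

lemma mm_one {R : Type*} [CommRing R] : mm (1 : SpecialLinearGroup (Fin 4) R) = 1 := rfl

lemma mm_det {R : Type*} [CommRing R] (A : SpecialLinearGroup (Fin 4) R) : (mm A).det = 1 := A.2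

section elem
variable {R : Type*} [CommRing R]

lemma EE_inv {i j : Fin 4} (h : i ≠ j) (x : R) : (EE h x)⁻¹ = EE h (-x) :=
  SpecialLinearGroup.transvection_inv h x

lemma EE_comm {i j k : Fin 4} (hij : i ≠ j) (hjk : j ≠ k) (hik : i ≠ k) (a b : R) :
    EE hij a * EE hjk b * (EE hij a)⁻¹ * (EE hjk b)⁻¹ = EE hik (a * b) := by
  rw [EE_inv, EE_inv]
  apply SLext
  simp only [mm_mul, EE_coe]
  simp [mul_add, add_mul, single_mul_single_of_ne, single_mul_single_same, hij, hjk, hik,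
    hij.symm, hjk.symm, hik.symm, ← single_neg]
  abel

lemma all_EE_mem (N : Subgroup (SpecialLinearGroup (Fin 4) R)) [hN : N.Normal] (a : R)
    (h : EE (show (2 : Fin 4) ≠ 3 by decide) a ∈ N) :
    ∀ (i j : Fin 4) (hij : i ≠ j), EE hij a ∈ N := by
  have left : ∀ {i j k : Fin 4} (hij : i ≠ j) (hjk : j ≠ k) (hik : i ≠ k),
      EE hjk a ∈ N → EE hik a ∈ N := by
    intro i j k hij hjk hik hm
    have := EE_comm hij hjk hik 1 a
    rw [one_mul] at this
    rw [← this]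
    exact N.mul_mem (hN.conj_mem _ hm _) (N.inv_mem hm)
  have right : ∀ {i j k : Fin 4} (hij : i ≠ j) (hjk : j ≠ k) (hik : i ≠ k),
      EE hij a ∈ N → EE hik a ∈ N := by
    intro i j k hij hjk hik hm
    have := EE_comm hij hjk hik a 1
    rw [mul_one] at this
    rw [← this, mul_assoc, mul_assoc, ← mul_assoc (EE hjk 1)]
    exact N.mul_mem hm (hN.conj_mem _ (N.inv_mem hm) _)
  have h1 : ∀ (i : Fin 4) (hi : i ≠ 3), EE hi a ∈ N := by
    intro i hi
    by_cases h2 : i = 2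
    · subst h2; exact h
    · exact left h2 (by decide) hi h
  have h2 : ∀ (i j : Fin 4) (hij : i ≠ j), i ≠ 3 → EE hij a ∈ N := by
    intro i j hij hi
    by_cases hj : j = 3
    · subst hj; exact h1 i hi
    · exact right hi (Ne.symm hj) hij (h1 i hi)
  intro i j hij
  by_cases hi : i = 3
  · subst hi
    obtain ⟨k, hk3, hkj⟩ : ∃ k : Fin 4, k ≠ 3 ∧ k ≠ j := by
      revert j; decide
    exact left hk3.symm hkj hij (h2 k j hkj hk3)
  · exact h2 i j hij hi

lemma diag2n_mem {F : Type*} [Field F] (N : Subgroup (SpecialLinearGroup (Fin 4) F))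
    (h : ∀ (i j : Fin 4) (hij : i ≠ j) (a : F), EE hij a ∈ N)
    {i j : Fin 4} (hij : i ≠ j) (a : F) (ha : a ≠ 0) :
    SpecialLinearGroup.diag2n hij a ha ∈ N := by
  have : SpecialLinearGroup.diag2n hij a ha =
      EE hij a * EE hij.symm (- a⁻¹) * EE hij a * EE hij (-1) * EE hij.symm 1 * EE hij (-1) := by
    apply SLext
    rw [show mm (SpecialLinearGroup.diag2n hij a ha) = diagonal (fun k ↦
      if k = i then a else if k = j then a⁻¹ else 1) from rfl]
    simp only [mm_mul, EE_coe]
    ext k l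
    simp [mul_add, add_mul, single_mul_single_of_ne, single_mul_single_same, hij, hij.symm, ha]
    simp only [diagonal_apply, one_apply, single_apply]
    clear h
    split_ifs <;> grind
  rw [this]
  exact N.mul_mem (N.mul_mem (N.mul_mem (N.mul_mem (N.mul_mem (h ..) (h ..)) (h ..)) (h ..))
    (h ..)) (h ..)

lemma field_mem {F : Type*} [Field F] (N : Subgroup (SpecialLinearGroup (Fin 4) F))
    (h : ∀ (i j : Fin 4) (hij : i ≠ j) (a : F), EE hij a ∈ N) (M) : M ∈ N :=
  SpecialLinearGroup.diagonal_transvection_induction' (· ∈ N) M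
    (fun i j hij c hc => diag2n_mem N h hij c hc) h (fun _ _ => N.mul_mem)

lemma sqzero_mem (N : Subgroup (SpecialLinearGroup (Fin 4) R)) [hN : N.Normal] (I : Ideal R)
    (hI : ∀ a ∈ I, ∀ b ∈ I, a * b = 0)
    (h : ∀ (i j : Fin 4) (hij : i ≠ j), ∀ a ∈ I, EE hij a ∈ N)
    (M : SpecialLinearGroup (Fin 4) R)
    (hM : ∀ i j, mm M i j - (1 : Matrix (Fin 4) (Fin 4) R) i j ∈ I) : M ∈ N := by
  have hmul : ∀ X Y : Matrix (Fin 4) (Fin 4) R, (∀ i j, X i j ∈ I) → (∀ i j, Y i j ∈ I) →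
      X * Y = 0 := by
    intro X Y hX hY
    ext i j
    simp only [mul_apply, Matrix.zero_apply]
    exact Finset.sum_eq_zero fun k _ => hI _ (hX i k) _ (hY k j)
  let S : AddSubmonoid (Matrix (Fin 4) (Fin 4) R) :=
    { carrier := {X | (∀ i j, X i j ∈ I) ∧ ∃ n ∈ N, mm n = 1 + X}
      zero_mem' := ⟨fun i j => I.zero_mem, 1, N.one_mem, by simp [mm_one]⟩
      add_mem' := by
        rintro X Y ⟨hX, n, hn, hnX⟩ ⟨hY, m, hm, hmY⟩
        refine ⟨fun i j => I.add_mem (hX i j) (hY i j), n * m, N.mul_mem hn hm, ?_⟩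
        rw [mm_mul, hnX, hmY, mul_add, add_mul, add_mul, hmul X Y hX hY]
        simp [add_assoc] }
  have hsingleI : ∀ (i j : Fin 4), ∀ a ∈ I, ∀ k l, single i j a k l ∈ I := by
    intro i j a ha k l
    rw [single_apply]; split_ifs
    · exact ha
    · exact I.zero_mem
  have hs : ∀ (i j : Fin 4) (hij : i ≠ j), ∀ a ∈ I, single i j a ∈ S := fun i j hij a ha =>
    ⟨hsingleI i j a ha, EE hij a, h i j hij a ha, rfl⟩
  have hd : ∀ (i j : Fin 4), ∀ a ∈ I, single i i a - single j j a ∈ S := by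
    intro i j a ha
    by_cases hij : i = j
    · subst hij; rw [sub_self]; exact S.zero_mem
    have h1 : single i i a - single j j a - single i j a + single j i a ∈ S := by
      refine ⟨fun k l => ?_, EE hij 1 * EE (Ne.symm hij) a * (EE hij 1)⁻¹,
        hN.conj_mem _ (h _ _ _ _ ha) _, ?_⟩
      · exact I.add_mem (I.sub_mem (I.sub_mem (hsingleI _ _ _ ha _ _) (hsingleI _ _ _ ha _ _))
          (hsingleI _ _ _ ha _ _)) (hsingleI _ _ _ ha _ _)
      · rw [EE_inv]
        simp only [mm_mul, EE_coe]
        have := Ne.symm hij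
        simp [mul_add, add_mul, single_mul_single_of_ne, single_mul_single_same, hij, this,
          ← single_neg]
        abel
    have h2 := S.add_mem (S.add_mem h1 (hs i j hij a ha)) (hs j i (Ne.symm hij) (-a) (I.neg_mem ha))
    convert h2 using 1
    rw [← single_neg]; abel
  set X := mm M - 1 with hX
  have hXI : ∀ i j, X i j ∈ I := hM
  have hdec : X - single 3 3 (∑ i, X i i) ∈ S := by
    have : X - single 3 3 (∑ i, X i i) = ∑ i, ∑ j, (if i = j then
        single i i (X i i) - single 3 3 (X i i) else single i j (X i j)) := by
      clear_value X
      ext k l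
      fin_cases k <;> fin_cases l <;> simp [Fin.sum_univ_four] <;> ring
    rw [this]
    refine S.sum_mem fun i _ => S.sum_mem fun j _ => ?_
    split_ifs with hij
    · exact hd _ _ _ (hXI _ _)
    · exact hs _ _ hij _ (hXI _ _)
  obtain ⟨hYI, n, hn, hnY⟩ := hdec
  set t := ∑ i, X i i with ht
  have htI : t ∈ I := I.sum_mem fun i _ => hXI i i
  have hMn : mm M = mm n * (1 + single 3 3 t) := by
    have hMX : mm M = 1 + X := by rw [hX]; abel
    rw [hnY, hMX, mul_add, mul_one, add_mul, hmul _ _ hYI (hsingleI _ _ _ htI), one_mul, add_zero]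
    abel
  have hdet := congrArg det hMn
  rw [det_mul, mm_det, mm_det, one_mul] at hdet
  have hdiag : (1 + single 3 3 t : Matrix (Fin 4) (Fin 4) R) = diagonal ![1, 1, 1, 1 + t] := by
    ext k l
    fin_cases k <;> fin_cases l <;> simp
  rw [hdiag, det_diagonal] at hdet
  have ht0 : t = 0 := by simpa [Fin.prod_univ_four] using hdet
  rw [ht0] at hMn
  have : M = n := SLext (by simpa using hMn)
  rwa [this]

end elem

section rep
variable {V : Type*} [NormedAddCommGroup V] [InnerProductSpace ℂ V] [FiniteDimensional ℂ V]

lemma exists_eig (W : Submodule ℂ V) (hW : W ≠ ⊥) (T : V →L[ℂ] V) (hT : ∀ w ∈ W, T w ∈ W) :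
    ∃ μ : ℂ, ∃ w ∈ W, w ≠ 0 ∧ T w = μ • w := by
  haveI : Nontrivial W := Submodule.nontrivial_iff_ne_bot.mpr hW
  obtain ⟨μ, hμ⟩ := Module.End.exists_eigenvalue ((T : V →ₗ[ℂ] V).restrict hT)
  obtain ⟨w, hw⟩ := hμ.exists_hasEigenvector
  refine ⟨μ, w, w.2, fun h => hw.2 (Subtype.ext h), ?_⟩
  have := congrArg Subtype.val hw.apply_eq_smul
  simpa using this

/-- Eigenspace as a submodule. -/
def eigS (T : V →L[ℂ] V) (μ : ℂ) : Submodule ℂ V where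
  carrier := {w | T w = μ • w}
  zero_mem' := by simp
  add_mem' := by
    intro a b ha hb
    simp only [Set.mem_setOf_eq] at *
    rw [map_add, ha, hb, smul_add]
  smul_mem' := by
    intro c a ha
    simp only [Set.mem_setOf_eq] at *
    rw [map_smul, ha, smul_comm]

lemma exists_eig2 (W : Submodule ℂ V) (hW : W ≠ ⊥) (T S : V →L[ℂ] V) (hT : ∀ w ∈ W, T w ∈ W)
    (hS : ∀ w ∈ W, S w ∈ W) (hTS : ∀ w, T (S w) = S (T w)) :
    ∃ μ ν : ℂ, ∃ w ∈ W, w ≠ 0 ∧ T w = μ • w ∧ S w = ν • w := by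
  obtain ⟨μ, w, hw, hw0, hTw⟩ := exists_eig W hW T hT
  have hne : W ⊓ eigS T μ ≠ ⊥ := (Submodule.ne_bot_iff _).mpr ⟨w, ⟨hw, hTw⟩, hw0⟩
  obtain ⟨ν, w', hw', hw0', hSw⟩ := exists_eig (W ⊓ eigS T μ) hne S (by
    rintro w ⟨h1, h2⟩
    refine ⟨hS w h1, ?_⟩
    change T (S w) = μ • S w
    rw [hTS, show T w = μ • w from h2, map_smul])
  exact ⟨μ, ν, w', hw'.1, hw0', hw'.2, hSw⟩

lemma exists_eig3 (W : Submodule ℂ V) (hW : W ≠ ⊥) (T S U : V →L[ℂ] V) (hT : ∀ w ∈ W, T w ∈ W)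
    (hS : ∀ w ∈ W, S w ∈ W) (hU : ∀ w ∈ W, U w ∈ W) (hTS : ∀ w, T (S w) = S (T w))
    (hTU : ∀ w, T (U w) = U (T w)) (hSU : ∀ w, S (U w) = U (S w)) :
    ∃ μ ν ξ : ℂ, ∃ w ∈ W, w ≠ 0 ∧ T w = μ • w ∧ S w = ν • w ∧ U w = ξ • w := by
  obtain ⟨μ, w, hw, hw0, hTw⟩ := exists_eig W hW T hT
  have hne : W ⊓ eigS T μ ≠ ⊥ := (Submodule.ne_bot_iff _).mpr ⟨w, ⟨hw, hTw⟩, hw0⟩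
  have aux : ∀ S : V →L[ℂ] V, (∀ w ∈ W, S w ∈ W) → (∀ w, T (S w) = S (T w)) →
      ∀ w ∈ W ⊓ eigS T μ, S w ∈ W ⊓ eigS T μ := by
    rintro S hS hTS w ⟨h1, h2⟩
    refine ⟨hS w h1, ?_⟩
    change T (S w) = μ • S w
    rw [hTS, show T w = μ • w from h2, map_smul]
  obtain ⟨ν, ξ, w', hw', hw0', hSw, hUw⟩ := exists_eig2 (W ⊓ eigS T μ) hne S U (aux S hS hTS)
    (aux U hU hTU) hSU
  exact ⟨μ, ν, ξ, w', hw'.1, hw0', hw'.2, hSw, hUw⟩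

variable {N : ℕ} [NeZero N]
  (φ : SpecialLinearGroup (Fin 4) (ZMod N) →* unitary (V →L[ℂ] V))

/-- The operator attached to a group element. -/
noncomputable def op (g : SpecialLinearGroup (Fin 4) (ZMod N)) : V →L[ℂ] V := (φ g : V →L[ℂ] V)

lemma op_mul (g h) (v : V) : op φ (g * h) v = op φ g (op φ h v) := by
  simp [op]

lemma op_one (v : V) : op φ 1 v = v := by simp [op]

lemma op_ne {v : V} (hv : v ≠ 0) (g) : op φ g v ≠ 0 := by
  intro h
  apply hv
  rw [← op_one φ v, ← inv_mul_cancel g, op_mul, h, map_zero]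

lemma op_pow_eig {g} {v : V} {μ : ℂ} (h : op φ g v = μ • v) (n : ℕ) :
    op φ (g ^ n) v = μ ^ n • v := by
  induction n with
  | zero => simp [op_one]
  | succ n ih => rw [pow_succ, op_mul, h, map_smul, ih, smul_smul, pow_succ, mul_comm]

lemma EE_pow {R : Type*} [CommRing R] {i j : Fin 4} (h : i ≠ j) (x : R) (n : ℕ) :
    EE h x ^ n = EE h (n * x) := by
  induction n with
  | zero =>
    rw [pow_zero, Nat.cast_zero, zero_mul]
    exact (SpecialLinearGroup.transvection_coeff_zero h).symm
  | succ n ih =>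
    rw [pow_succ, ih, Nat.cast_succ, add_mul, one_mul]
    exact (SpecialLinearGroup.transvection_add h _ _).symm

local notation "ψ" => (ZMod.stdAddChar (N := N))

lemma psi_prim : IsPrimitiveRoot (ψ 1) N := by
  have := Complex.isPrimitiveRoot_exp N (NeZero.ne N)
  convert this using 1
  have h := ZMod.stdAddChar_coe (N := N) 1
  simpa using h

lemma psi_nat (k : ℕ) : ψ (k : ZMod N) = ψ 1 ^ k := by
  rw [← AddChar.map_nsmul_eq_pow]; simp

lemma exists_char {i j : Fin 4} (hij : i ≠ j) {v : V} (hv : v ≠ 0) {μ : ℂ}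
    (h : op φ (EE hij 1) v = μ • v) :
    ∃ a : ZMod N, ∀ x, op φ (EE hij x) v = ψ (a * x) • v := by
  have hN : μ ^ N = 1 := by
    have h1 := op_pow_eig φ h N
    rw [EE_pow] at h1
    have h2 : EE hij ((N : ZMod N) * 1) = 1 := by
      rw [ZMod.natCast_self, zero_mul]; exact SpecialLinearGroup.transvection_coeff_zero hij
    rw [h2, op_one] at h1
    have h3 : (μ ^ N - 1) • v = 0 := by rw [sub_smul, ← h1, one_smul, sub_self]
    rcases smul_eq_zero.mp h3 with h4 | h4
    · exact sub_eq_zero.mp h4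
    · exact absurd h4 hv
  obtain ⟨k, -, hk⟩ := (psi_prim (N := N)).eq_pow_of_pow_eq_one hN
  refine ⟨k, fun x => ?_⟩
  have h1 := op_pow_eig φ h x.val
  rw [EE_pow, mul_one, ZMod.natCast_zmod_val] at h1
  rw [h1, ← hk, ← pow_mul, ← psi_nat, Nat.cast_mul, ZMod.natCast_zmod_val]

lemma conj_eig {g k k'} (h : g * k = k' * g) {v : V} {μ : ℂ} (hv : op φ k' v = μ • v) :
    op φ k (op φ g⁻¹ v) = μ • op φ g⁻¹ v := by
  rw [← op_mul, show k * g⁻¹ = g⁻¹ * k' by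
    rw [eq_inv_mul_iff_mul_eq, ← mul_assoc, h, mul_inv_cancel_right], op_mul, hv, map_smul]

end rep

section matid
variable {R : Type*} [CommRing R]

lemma EE_commute {i j k l : Fin 4} (hij : i ≠ j) (hkl : k ≠ l) (hjk : j ≠ k) (hil : i ≠ l)
    (a b : R) : EE hij a * EE hkl b = EE hkl b * EE hij a := by
  apply SLext
  simp only [mm_mul, EE_coe]
  simp [mul_add, add_mul, single_mul_single_of_ne, hjk, hil.symm]
  abel

lemma EE_push {i j k : Fin 4} (hij : i ≠ j) (hjk : j ≠ k) (hik : i ≠ k) (a b : R) :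
    EE hjk b * EE hij a = EE hij a * (EE hjk b * EE hik (-(a * b))) := by
  apply SLext
  simp only [mm_mul, EE_coe]
  simp [mul_add, add_mul, single_mul_single_of_ne, hij.symm, hjk.symm, hik.symm, ← single_neg]
  abel

/-- First conjugating matrix. -/
def h1 (a b c c' : R) (hc : c * c' = 1) : SpecialLinearGroup (Fin 4) R :=
  ⟨!![c, 0, 0, 0; 0, 1, 0, 0; -a, -(b * c'), c', 0; 0, 0, 0, 1], by
    simp [Matrix.det_succ_row_zero, Fin.sum_univ_succ, hc]⟩

lemma mm_h1 (a b c c' : R) (hc : c * c' = 1) : mm (h1 a b c c' hc) =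
  !![c, 0, 0, 0; 0, 1, 0, 0; -a, -(b * c'), c', 0; 0, 0, 0, 1] := rfl

/-- Second conjugating matrix. -/
def h2 (s : R) : SpecialLinearGroup (Fin 4) R :=
  ⟨!![0, 1, 0, 0; -1, -s, 0, 0; 0, 0, 1, 0; 0, 0, 0, 1], by
    simp [Matrix.det_succ_row_zero, Fin.sum_univ_succ, Fin.succAbove]⟩

lemma mm_h2 (s : R) : mm (h2 s) =
  !![0, 1, 0, 0; -1, -s, 0, 0; 0, 0, 1, 0; 0, 0, 0, 1] := rfl

abbrev E03 (x : R) := EE (show (0 : Fin 4) ≠ 3 by decide) x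
abbrev E13 (x : R) := EE (show (1 : Fin 4) ≠ 3 by decide) x
abbrev E23 (x : R) := EE (show (2 : Fin 4) ≠ 3 by decide) x
abbrev E02 (x : R) := EE (show (0 : Fin 4) ≠ 2 by decide) x
abbrev E12 (x : R) := EE (show (1 : Fin 4) ≠ 2 by decide) x
abbrev E01 (x : R) := EE (show (0 : Fin 4) ≠ 1 by decide) x

lemma h1_03 (a b c c' : R) (hc : c * c' = 1) (x : R) :
    h1 a b c c' hc * E03 x = (E03 (c * x) * E23 (-(a * x))) * h1 a b c c' hc := by
  apply SLext
  simp only [mm_mul, EE_coe, mm_h1]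
  ext k l
  fin_cases k <;> fin_cases l <;> simp [Matrix.mul_apply, Fin.sum_univ_four, Matrix.one_apply]

lemma h1_13 (a b c c' : R) (hc : c * c' = 1) (x : R) :
    h1 a b c c' hc * E13 x = (E13 x * E23 (-(b * c' * x))) * h1 a b c c' hc := by
  apply SLext
  simp only [mm_mul, EE_coe, mm_h1]
  ext k l
  fin_cases k <;> fin_cases l <;> simp [Matrix.mul_apply, Fin.sum_univ_four, Matrix.one_apply]

lemma h1_23 (a b c c' : R) (hc : c * c' = 1) (x : R) :
    h1 a b c c' hc * E23 x = E23 (c' * x) * h1 a b c c' hc := by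
  apply SLext
  simp only [mm_mul, EE_coe, mm_h1]
  ext k l
  fin_cases k <;> fin_cases l <;> simp [Matrix.mul_apply, Fin.sum_univ_four, Matrix.one_apply]

lemma h2_12 (s x : R) : h2 s * E12 x = (E02 x * E12 (-(s * x))) * h2 s := by
  apply SLext
  simp only [mm_mul, EE_coe, mm_h2]
  ext k l
  fin_cases k <;> fin_cases l <;> simp [Matrix.mul_apply, Fin.sum_univ_four, Matrix.one_apply]

lemma h2_13 (s x : R) : h2 s * E13 x = (E03 x * E13 (-(s * x))) * h2 s := by
  apply SLext
  simp only [mm_mul, EE_coe, mm_h2]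
  ext k l
  fin_cases k <;> fin_cases l <;> simp [Matrix.mul_apply, Fin.sum_univ_four, Matrix.one_apply]

lemma h2_23 (s x : R) : h2 s * E23 x = E23 x * h2 s := by
  apply SLext
  simp only [mm_mul, EE_coe, mm_h2]
  ext k l
  fin_cases k <;> fin_cases l <;> simp [Matrix.mul_apply, Fin.sum_univ_four, Matrix.one_apply]

lemma h3_12 (s x : R) : E01 (-s) * E12 x = (E02 (-(s * x)) * E12 x) * E01 (-s) := by
  apply SLext
  simp only [mm_mul, EE_coe]
  ext k l
  fin_cases k <;> fin_cases l <;> simp [Matrix.mul_apply, Fin.sum_univ_four, Matrix.one_apply]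

lemma h3_13 (s x : R) : E01 (-s) * E13 x = (E03 (-(s * x)) * E13 x) * E01 (-s) := by
  apply SLext
  simp only [mm_mul, EE_coe]
  ext k l
  fin_cases k <;> fin_cases l <;> simp [Matrix.mul_apply, Fin.sum_univ_four, Matrix.one_apply]

lemma h3_23 (s x : R) : E01 (-s) * E23 x = E23 x * E01 (-s) := by
  apply EE_commute <;> decide

end matid

lemma xyz_eq (p r : ℕ) (x y z : ℤ) : xyzMat p r x y z =
    E23 (y : ZMod (p ^ r)) * (E12 (x : ZMod (p ^ r)) * E13 (z : ZMod (p ^ r))) := by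
  apply SLext
  simp only [mm_mul, EE_coe]
  rw [show mm (xyzMat p r x y z) = !![1, 0, 0, 0; 0, 1, (x : ZMod (p ^ r)), (z : ZMod (p ^ r));
      0, 0, 1, (y : ZMod (p ^ r)); 0, 0, 0, 1] from rfl]
  ext k l
  fin_cases k <;> fin_cases l <;> simp [Matrix.mul_apply, Fin.sum_univ_four, Matrix.one_apply]

section arith

lemma dvd_tot (p : ℕ) (hp : p.Prime) (r : ℕ) (a b : ZMod (p ^ r)) : a ∣ b ∨ b ∣ a := by
  haveI : Fact p.Prime := ⟨hp⟩
  haveI : NeZero (p ^ r) := ⟨pow_ne_zero _ hp.ne_zero⟩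
  have key : ∀ c : ZMod (p ^ r), ∃ c' : ℤ_[p], PadicInt.toZModPow r c' = c := fun c =>
    ⟨(c.val : ℤ_[p]), by rw [map_natCast, ZMod.natCast_zmod_val]⟩
  obtain ⟨a', rfl⟩ := key a
  obtain ⟨b', rfl⟩ := key b
  rcases ValuationRing.dvd_total a' b' with h | h
  · exact Or.inl (map_dvd _ h)
  · exact Or.inr (map_dvd _ h)

lemma unit_of (p : ℕ) (hp : p.Prime) (r : ℕ) (hr : 1 ≤ r) (c : ZMod (p ^ r))
    (h : c * (p : ZMod (p ^ r)) ^ (r - 1) ≠ 0) : ∃ c', c * c' = 1 := by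
  haveI : NeZero (p ^ r) := ⟨pow_ne_zero _ hp.ne_zero⟩
  by_contra hc
  apply h
  have h1 : ¬ IsUnit ((c.val : ℕ) : ZMod (p ^ r)) := by
    rw [ZMod.natCast_zmod_val]
    intro hu
    exact hc hu.exists_right_inv
  rw [ZMod.isUnit_iff_coprime] at h1
  have h2 : p ∣ c.val := by
    by_contra h3
    exact h1 (Nat.Coprime.pow_right _ ((Nat.Prime.coprime_iff_not_dvd hp).mpr h3).symm)
  obtain ⟨d, hd⟩ := h2
  rw [← ZMod.natCast_zmod_val c, hd, Nat.cast_mul, mul_right_comm, ← pow_succ',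
    Nat.sub_add_cancel hr, ← Nat.cast_pow, ZMod.natCast_self, zero_mul]

lemma mem_span_of_cast (p : ℕ) (hp : p.Prime) (r : ℕ) (x : ZMod (p ^ r)) (hdv : p ^ (r - 1) ∣ p ^ r)
    (h : ZMod.castHom hdv (ZMod (p ^ (r - 1))) x = 0) :
    x ∈ Ideal.span {(p : ZMod (p ^ r)) ^ (r - 1)} := by
  haveI : NeZero (p ^ r) := ⟨pow_ne_zero _ hp.ne_zero⟩
  rw [← ZMod.natCast_zmod_val x] at h ⊢
  rw [map_natCast, ZMod.natCast_eq_zero_iff] at h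
  rw [Ideal.mem_span_singleton, ← Nat.cast_pow]
  exact Nat.cast_dvd_cast h

lemma ker_le (p : ℕ) (hp : p.Prime) (r : ℕ) (hr : 1 ≤ r) (hdv : p ^ (r - 1) ∣ p ^ r)
    (K : Subgroup (SpecialLinearGroup (Fin 4) (ZMod (p ^ r)))) [K.Normal]
    (h : E23 ((p : ZMod (p ^ r)) ^ (r - 1)) ∈ K) :
    (Matrix.SpecialLinearGroup.map (n := Fin 4)
        (ZMod.castHom hdv
          (ZMod (p ^ (r - 1))))).ker ≤ K := by
  haveI : NeZero (p ^ r) := ⟨pow_ne_zero _ hp.ne_zero⟩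
  have hall : ∀ (i j : Fin 4) (hij : i ≠ j),
      ∀ a ∈ Ideal.span {(p : ZMod (p ^ r)) ^ (r - 1)}, EE hij a ∈ K := by
    intro i j hij a ha
    obtain ⟨t, rfl⟩ := Ideal.mem_span_singleton'.mp ha
    have := K.pow_mem (all_EE_mem K _ h i j hij) t.val
    rwa [EE_pow, ZMod.natCast_zmod_val] at this
  intro M hM
  rcases Nat.eq_or_lt_of_le hr with h1 | h1
  · subst h1
    haveI : Fact (p ^ 1).Prime := ⟨by rwa [pow_one]⟩
    exact field_mem (F := ZMod (p ^ 1)) K (fun i j hij a => hall i j hij a (by simp)) M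
  · refine sqzero_mem K _ ?_ hall M ?_
    · intro a ha b hb
      obtain ⟨t, rfl⟩ := Ideal.mem_span_singleton'.mp ha
      obtain ⟨s, rfl⟩ := Ideal.mem_span_singleton'.mp hb
      have : (p : ZMod (p ^ r)) ^ (r - 1) * (p : ZMod (p ^ r)) ^ (r - 1) = 0 := by
        rw [← pow_add, show r - 1 + (r - 1) = r + (r - 2) by omega, pow_add, ← Nat.cast_pow,
          ZMod.natCast_self, zero_mul]
      rw [mul_mul_mul_comm, this, mul_zero]
    · intro i j
      apply mem_span_of_cast p hp r _ hdv
      rw [MonoidHom.mem_ker] at hM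
      have h2 := congrFun (congrFun (congrArg mm hM) i) j
      rw [map_sub, sub_eq_zero]
      refine Eq.trans h2 ?_
      rw [mm_one, Matrix.one_apply, Matrix.one_apply]
      split_ifs
      · exact (map_one _).symm
      · exact (map_zero _).symm

end arith

section main
variable {V : Type*} [NormedAddCommGroup V] [InnerProductSpace ℂ V] [FiniteDimensional ℂ V]
variable {N : ℕ} [NeZero N]
  (φ : SpecialLinearGroup (Fin 4) (ZMod N) →* unitary (V →L[ℂ] V))

local notation "ψ" => (ZMod.stdAddChar (N := N))

lemma find_sub (g : SpecialLinearGroup (Fin 4) (ZMod N)) (hgN : g ^ N = 1) (hg : φ g ≠ 1) :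
    ∃ W : Submodule ℂ V, W ≠ ⊥ ∧ (∀ h, g * h = h * g → ∀ w ∈ W, op φ h w ∈ W) ∧
      ∀ w ∈ W, op φ g w = w → w = 0 := by
  let P : V →L[ℂ] V := ∑ k ∈ Finset.range N, op φ (g ^ k)
  have hP : ∀ w, P w = ∑ k ∈ Finset.range N, op φ (g ^ k) w := fun w => by
    simp [P, ContinuousLinearMap.sum_apply]
  refine ⟨LinearMap.ker (P : V →ₗ[ℂ] V), ?_, ?_, ?_⟩
  · obtain ⟨u, hu⟩ : ∃ u, op φ g u ≠ u := by
      by_contra hcon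
      push Not at hcon
      apply hg
      apply Subtype.ext
      ext u
      exact hcon u
    refine (Submodule.ne_bot_iff _).mpr ⟨op φ g u - u, ?_, sub_ne_zero.mpr hu⟩
    change P (op φ g u - u) = 0
    rw [hP]
    have : ∀ k ∈ Finset.range N, op φ (g ^ k) (op φ g u - u) =
        op φ (g ^ (k + 1)) u - op φ (g ^ k) u := by
      intro k _
      rw [map_sub, ← op_mul, ← pow_succ]
    rw [Finset.sum_congr rfl this, Finset.sum_range_sub (fun k => op φ (g ^ k) u), hgN, pow_zero,
      sub_self]
  · intro h hh w hw
    change P (op φ h w) = 0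
    have hw' : P w = 0 := hw
    have : P (op φ h w) = op φ h (P w) := by
      rw [hP, hP, map_sum]
      refine Finset.sum_congr rfl fun k _ => ?_
      rw [← op_mul, ← op_mul, (Commute.pow_left (show Commute g h from hh) k).eq]
    rw [this, hw', map_zero]
  · intro w hw hgw
    have hw' : P w = 0 := hw
    rw [hP] at hw'
    have : ∀ k ∈ Finset.range N, op φ (g ^ k) w = w := by
      intro k _
      have := op_pow_eig φ (μ := 1) (by rw [hgw, one_smul]) k
      simpa using this
    rw [Finset.sum_congr rfl this, Finset.sum_const, Finset.card_range] at hw'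
    rw [← Nat.cast_smul_eq_nsmul ℂ] at hw'
    rcases smul_eq_zero.mp hw' with h | h
    · exact absurd (Nat.cast_eq_zero.mp h) (NeZero.ne N)
    · exact h

lemma op_mul_eig {g h} {v : V} {a b : ℂ} (hg : op φ g v = a • v) (hh : op φ h v = b • v) :
    op φ (g * h) v = (a * b) • v := by
  rw [op_mul, hh, map_smul, hg, smul_smul, mul_comm]

/-- Step 1: a joint eigenvector with primitive last component. -/
lemma step1 (q : ZMod N) (hq : φ (E23 q) ≠ 1) :
    ∃ a b c : ZMod N, c * q ≠ 0 ∧ ∃ v : V, v ≠ 0 ∧ (∀ x, op φ (E03 x) v = ψ (a * x) • v) ∧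
      (∀ x, op φ (E13 x) v = ψ (b * x) • v) ∧ (∀ x, op φ (E23 x) v = ψ (c * x) • v) := by
  obtain ⟨W, hW, hcomm, hfix⟩ := find_sub φ (E23 q) (by
    rw [EE_pow, ZMod.natCast_self, zero_mul]
    exact SpecialLinearGroup.transvection_coeff_zero _) hq
  obtain ⟨α, β, γ, v, hvW, hv, h1, h2, h3⟩ := exists_eig3 W hW (op φ (E03 1)) (op φ (E13 1))
    (op φ (E23 1))
    (hcomm _ (EE_commute _ _ (by decide) (by decide) _ _))
    (hcomm _ (EE_commute _ _ (by decide) (by decide) _ _))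
    (hcomm _ (EE_commute _ _ (by decide) (by decide) _ _))
    (fun w => by rw [← op_mul, ← op_mul, EE_commute _ _ (by decide) (by decide)])
    (fun w => by rw [← op_mul, ← op_mul, EE_commute _ _ (by decide) (by decide)])
    (fun w => by rw [← op_mul, ← op_mul, EE_commute _ _ (by decide) (by decide)])
  obtain ⟨a, ha⟩ := exists_char φ _ hv h1
  obtain ⟨b, hb⟩ := exists_char φ _ hv h2
  obtain ⟨c, hc⟩ := exists_char φ _ hv h3
  refine ⟨a, b, c, fun h0 => hv (hfix v hvW ?_), v, hv, ha, hb, hc⟩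
  rw [hc, h0, AddChar.map_zero_eq_one, one_smul]

lemma step2 {a b c c' : ZMod N} (hcc : c * c' = 1) {v : V} (hv : v ≠ 0)
    (ha : ∀ x, op φ (E03 x) v = ψ (a * x) • v)
    (hb : ∀ x, op φ (E13 x) v = ψ (b * x) • v) (hc : ∀ x, op φ (E23 x) v = ψ (c * x) • v) :
    ∃ w : V, w ≠ 0 ∧ (∀ x, op φ (E03 x) w = w) ∧
      (∀ x, op φ (E13 x) w = w) ∧ (∀ x, op φ (E23 x) w = ψ x • w) := by
  refine ⟨op φ (h1 a b c c' hcc)⁻¹ v, op_ne φ hv _, fun x => ?_, fun x => ?_, fun x => ?_⟩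
  · rw [conj_eig φ (h1_03 a b c c' hcc x) (op_mul_eig φ (ha _) (hc _)), ← AddChar.map_add_eq_mul,
      show a * (c * x) + c * -(a * x) = 0 by ring, AddChar.map_zero_eq_one, one_smul]
  · rw [conj_eig φ (h1_13 a b c c' hcc x) (op_mul_eig φ (hb _) (hc _)), ← AddChar.map_add_eq_mul,
      show b * x + c * -(b * c' * x) = 0 by linear_combination (-b * x) * hcc,
      AddChar.map_zero_eq_one, one_smul]
  · rw [conj_eig φ (h1_23 a b c c' hcc x) (hc _), ← mul_assoc, hcc, one_mul]

lemma step3 {v : V} (hv : v ≠ 0) (h03 : ∀ x, op φ (E03 x) v = v)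
    (h13 : ∀ x, op φ (E13 x) v = v) (h23 : ∀ x, op φ (E23 x) v = ψ x • v) :
    ∃ a b : ZMod N, ∃ w : V, w ≠ 0 ∧ (∀ x, op φ (E03 x) w = w) ∧
      (∀ x, op φ (E13 x) w = w) ∧ (∀ x, op φ (E23 x) w = ψ x • w) ∧
      (∀ x, op φ (E02 x) w = ψ (a * x) • w) ∧ (∀ x, op φ (E12 x) w = ψ (b * x) • w) := by
  let W : Submodule ℂ V := ⨅ x : ZMod N, eigS (op φ (E03 x)) 1 ⊓ eigS (op φ (E13 x)) 1 ⊓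
    eigS (op φ (E23 x)) (ψ x)
  have hmem : ∀ w, w ∈ W ↔ ∀ x, (op φ (E03 x) w = w ∧ op φ (E13 x) w = w) ∧
      op φ (E23 x) w = ψ x • w := by
    intro w
    simp only [W, Submodule.mem_iInf, Submodule.mem_inf]
    refine forall_congr' fun x => ?_
    change (op φ (E03 x) w = (1 : ℂ) • w ∧ op φ (E13 x) w = (1 : ℂ) • w) ∧ _ ↔ _
    rw [one_smul]
    rfl
  have hW : W ≠ ⊥ := (Submodule.ne_bot_iff _).mpr
    ⟨v, (hmem v).mpr fun x => ⟨⟨h03 x, h13 x⟩, h23 x⟩, hv⟩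
  obtain ⟨μ, ν, w, hwW, hw, hm, hn⟩ := exists_eig2 W hW (op φ (E02 1)) (op φ (E12 1))
    (by
      intro w hw
      rw [hmem] at hw ⊢
      intro x
      refine ⟨⟨?_, ?_⟩, ?_⟩
      · rw [← op_mul, EE_commute _ _ (by decide) (by decide), op_mul, (hw x).1.1]
      · rw [← op_mul, EE_commute _ _ (by decide) (by decide), op_mul, (hw x).1.2]
      · rw [← op_mul, EE_push _ _ (show (0 : Fin 4) ≠ 3 by decide), op_mul, op_mul, (hw _).1.1,
          (hw x).2, map_smul])
    (by
      intro w hw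
      rw [hmem] at hw ⊢
      intro x
      refine ⟨⟨?_, ?_⟩, ?_⟩
      · rw [← op_mul, EE_commute _ _ (by decide) (by decide), op_mul, (hw x).1.1]
      · rw [← op_mul, EE_commute _ _ (by decide) (by decide), op_mul, (hw x).1.2]
      · rw [← op_mul, EE_push _ _ (show (1 : Fin 4) ≠ 3 by decide), op_mul, op_mul, (hw _).1.2,
          (hw x).2, map_smul])
    (fun w => by rw [← op_mul, ← op_mul, EE_commute _ _ (by decide) (by decide)])
  rw [hmem] at hwW
  obtain ⟨a, ha⟩ := exists_char φ _ hw hm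
  obtain ⟨b, hb⟩ := exists_char φ _ hw hn
  exact ⟨a, b, w, hw, fun x => (hwW x).1.1, fun x => (hwW x).1.2, fun x => (hwW x).2, ha, hb⟩

lemma step4 {a b : ZMod N} (hab : a ∣ b ∨ b ∣ a) {w : V} (hw : w ≠ 0)
    (h03 : ∀ x, op φ (E03 x) w = w)
    (h13 : ∀ x, op φ (E13 x) w = w) (h23 : ∀ x, op φ (E23 x) w = ψ x • w)
    (h02 : ∀ x, op φ (E02 x) w = ψ (a * x) • w) (h12 : ∀ x, op φ (E12 x) w = ψ (b * x) • w) :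
    ∃ v : V, v ≠ 0 ∧ (∀ x, op φ (E12 x) v = v) ∧
      (∀ x, op φ (E13 x) v = v) ∧ (∀ x, op φ (E23 x) v = ψ x • v) := by
  have h03' : ∀ x, op φ (E03 x) w = (1 : ℂ) • w := fun x => by rw [h03, one_smul]
  have h13' : ∀ x, op φ (E13 x) w = (1 : ℂ) • w := fun x => by rw [h13, one_smul]
  rcases hab with ⟨s, rfl⟩ | ⟨s, rfl⟩
  · refine ⟨op φ (E01 (-s))⁻¹ w, op_ne φ hw _, fun x => ?_, fun x => ?_, fun x => ?_⟩
    · rw [conj_eig φ (h3_12 s x) (op_mul_eig φ (h02 _) (h12 _)), ← AddChar.map_add_eq_mul,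
        show a * -(s * x) + a * s * x = 0 by ring, AddChar.map_zero_eq_one, one_smul]
    · rw [conj_eig φ (h3_13 s x) (op_mul_eig φ (h03' _) (h13' _)), one_mul, one_smul]
    · rw [conj_eig φ (h3_23 s x) (h23 _)]
  · refine ⟨op φ (h2 s)⁻¹ w, op_ne φ hw _, fun x => ?_, fun x => ?_, fun x => ?_⟩
    · rw [conj_eig φ (h2_12 s x) (op_mul_eig φ (h02 _) (h12 _)), ← AddChar.map_add_eq_mul,
        show b * s * x + b * -(s * x) = 0 by ring, AddChar.map_zero_eq_one, one_smul]
    · rw [conj_eig φ (h2_13 s x) (op_mul_eig φ (h03' _) (h13' _)), one_mul, one_smul]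
    · rw [conj_eig φ (h2_23 s x) (h23 _)]

end main

theorem stmt11 (p : ℕ) (hp : p.Prime) (r : ℕ) (hr : 1 ≤ r)
    {V : Type*} [NormedAddCommGroup V] [InnerProductSpace ℂ V]
    [FiniteDimensional ℂ V] [Nontrivial V]
    (φ : Matrix.SpecialLinearGroup (Fin 4) (ZMod (p ^ r)) →* unitary (V →L[ℂ] V))
    (hirr : ∀ W : Submodule ℂ V,
      (∀ g, ∀ w ∈ W, (φ g : V →L[ℂ] V) w ∈ W) → W = ⊥ ∨ W = ⊤)
    (hnew : ¬ (Matrix.SpecialLinearGroup.map (n := Fin 4)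
        (ZMod.castHom (pow_dvd_pow p (by omega : r - 1 ≤ r))
          (ZMod (p ^ (r - 1))))).ker ≤ φ.ker) :
    ∃ v : V, v ≠ 0 ∧ ∀ x y z : ℤ,
      (φ (xyzMat p r x y z) : V →L[ℂ] V) v
        = Complex.exp (2 * Real.pi * Complex.I * ((y : ℂ) / (p : ℂ) ^ r)) • v := by
  have hN : NeZero (p ^ r) := ⟨pow_ne_zero _ hp.ne_zero⟩
  have hq : φ (E23 ((p : ZMod (p ^ r)) ^ (r - 1))) ≠ 1 := fun h =>
    hnew (ker_le p hp r hr _ φ.ker (MonoidHom.mem_ker.mpr h))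
  obtain ⟨a, b, c, hc0, v, hv, ha, hb, hc⟩ := step1 φ _ hq
  obtain ⟨c', hcc⟩ := unit_of p hp r hr c hc0
  obtain ⟨v, hv, h03, h13, h23⟩ := step2 φ hcc hv ha hb hc
  obtain ⟨a, b, v, hv, h03, h13, h23, h02, h12⟩ := step3 φ hv h03 h13 h23
  obtain ⟨v, hv, h12, h13, h23⟩ := step4 φ (dvd_tot p hp r a b) hv h03 h13 h23 h02 h12
  refine ⟨v, hv, fun x y z => ?_⟩
  change op φ (xyzMat p r x y z) v = _
  rw [xyz_eq, op_mul, op_mul, h13, h12, h23, ZMod.stdAddChar_coe]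
  congr 2
  push_cast
  ring
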